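/- Suppose Σ_C contains a concept name A and Σ_R contains a role name R. Then the concept A has no finite characterisation w.r.t. L(∀,∃,−,⊓)[Σ_C,Σ_R]; in particular, L(∀,∃,−,⊓) does not admit finite characterisations. -/

import Mathlib

namespace DL

/-! ### Syntax of ALCQI concepts -/

/-- Roles: role names (indexed by ℕ) and inverse roles. -/
inductive Role where
  | name : ℕ → Role
  | inv  : ℕ → Role
deriving DecidableEq

/-- ALCQI concept expressions. -/
inductive Concept where
  | atom : ℕ → Concept
  | top  : Concept
  | bot  : Concept
  | and  : Concept → Concept → Concept
  | or   : Concept → Concept → Concept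
  | neg  : Concept → Concept
  | ex   : Role → Concept → Concept
  | all  : Role → Concept → Concept
  | atLeast : ℕ → Role → Concept → Concept
deriving DecidableEq

/-- The operators/constructors that a concept language may use. -/
inductive Op where
  | all | ex | ge | inv | and | or | top | bot | neg
deriving DecidableEq

/-! ### Interpretations and semantics -/

/-- An interpretation: a nonempty domain, interpretations of concept names
and of role names. -/
structure Interp where
  Δ : Type
  dom_nonempty : Nonempty Δ
  atom : ℕ → Set Δ
  rel : ℕ → Δ → Δ → Prop

def Role.sem (I : Interp) : Role → (I.Δ → I.Δ → Prop)
  | .name R => I.rel R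
  | .inv R  => fun d e => I.rel R e d

def Concept.sem (I : Interp) : Concept → Set I.Δ
  | .atom A => I.atom A
  | .top => Set.univ
  | .bot => ∅
  | .and C D => C.sem I ∩ D.sem I
  | .or C D => C.sem I ∪ D.sem I
  | .neg C => (C.sem I)ᶜ
  | .ex S C => {d | ∃ e, S.sem I d e ∧ e ∈ C.sem I}
  | .all S C => {d | ∀ e, S.sem I d e → e ∈ C.sem I}
  | .atLeast k S C => {d | ∃ s : Finset I.Δ, s.card = k ∧ ∀ e ∈ s, S.sem I d e ∧ e ∈ C.sem I}

/-! ### Concept languages L(Os)[SC, SR] -/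

def Role.inSig (Os : Finset Op) (SR : Finset ℕ) : Role → Prop
  | .name R => R ∈ SR
  | .inv R  => Op.inv ∈ Os ∧ R ∈ SR

/-- Membership of a concept in the language `L(Os)[SC, SR]`. -/
def Concept.inLang (Os : Finset Op) (SC SR : Finset ℕ) : Concept → Prop
  | .atom A => A ∈ SC
  | .top => Op.top ∈ Os
  | .bot => Op.bot ∈ Os
  | .and C D => Op.and ∈ Os ∧ C.inLang Os SC SR ∧ D.inLang Os SC SR
  | .or C D => Op.or ∈ Os ∧ C.inLang Os SC SR ∧ D.inLang Os SC SR
  | .neg C => Op.neg ∈ Os ∧ C.inLang Os SC SR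
  | .ex S C => Op.ex ∈ Os ∧ S.inSig Os SR ∧ C.inLang Os SC SR
  | .all S C => Op.all ∈ Os ∧ S.inSig Os SR ∧ C.inLang Os SC SR
  | .atLeast k S C => Op.ge ∈ Os ∧ 1 ≤ k ∧ S.inSig Os SR ∧ C.inLang Os SC SR

/-! ### DL-Lite ontologies -/

/-- Basic concepts: concept names, ∃R and ∃R⁻. -/
inductive Basic where
  | atom : ℕ → Basic
  | ex : Role → Basic
deriving DecidableEq

def Basic.sem (I : Interp) : Basic → Set I.Δ
  | .atom A => I.atom A
  | .ex S => {d | ∃ e, S.sem I d e}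

/-- A DL-Lite concept inclusion `B ⊑ C` where `C` is a basic concept
(`negated = false`) or a negated basic concept (`negated = true`). -/
structure CI where
  lhs : Basic
  rhs : Basic
  negated : Bool
deriving DecidableEq

def CI.sat (I : Interp) (ci : CI) : Prop :=
  if ci.negated then ci.lhs.sem I ⊆ (ci.rhs.sem I)ᶜ else ci.lhs.sem I ⊆ ci.rhs.sem I

/-- A DL-Lite ontology: a finite set (list) of concept inclusions. -/
abbrev Ontology := List CI

def Interp.satO (I : Interp) (Ont : Ontology) : Prop := ∀ ci ∈ Ont, ci.sat I

/-! ### Pointed interpretations, examples, characterisations -/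

structure PInterp where
  I : Interp
  pt : I.Δ

/-- A pointed interpretation is finite if its domain is finite. -/
def PInterp.finite (P : PInterp) : Prop := Finite P.I.Δ

/-- `C` fits a collection `(Epos, Eneg)` of labelled examples. -/
def Fits (C : Concept) (Epos Eneg : List PInterp) : Prop :=
  (∀ e ∈ Epos, e.pt ∈ C.sem e.I) ∧ (∀ e ∈ Eneg, e.pt ∉ C.sem e.I)

/-- Equivalence of concepts. -/
def CEquiv (C D : Concept) : Prop := ∀ I : Interp, C.sem I = D.sem I

/-- Equivalence of concepts relative to an ontology. -/
def CEquivO (Ont : Ontology) (C D : Concept) : Prop :=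
  ∀ I : Interp, I.satO Ont → C.sem I = D.sem I

/-- `⊨ C ⊑ D`. -/
def Subsumes (C D : Concept) : Prop := ∀ I : Interp, C.sem I ⊆ D.sem I

/-- `Ont ⊨ C ⊑ D`. -/
def SubsumesO (Ont : Ontology) (C D : Concept) : Prop :=
  ∀ I : Interp, I.satO Ont → C.sem I ⊆ D.sem I

/-- `(Epos, Eneg)` is a finite characterisation of `C` w.r.t. the
concept language (predicate) `L`: all examples are finite, `C` fits,
and every fitting concept of `L` is equivalent to `C`. -/
def FinChar (L : Concept → Prop) (C : Concept) (Epos Eneg : List PInterp) : Prop :=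
  (∀ e ∈ Epos ++ Eneg, e.finite) ∧
  Fits C Epos Eneg ∧
  ∀ D, L D → Fits D Epos Eneg → CEquiv C D

/-- Finite characterisation of `C` w.r.t. `L` under an ontology `Ont`:
all examples are finite and satisfy `Ont`, `C` fits, and every fitting
concept of `L` is equivalent to `C` relative to `Ont`. -/
def FinCharO (Ont : Ontology) (L : Concept → Prop) (C : Concept)
    (Epos Eneg : List PInterp) : Prop :=
  (∀ e ∈ Epos ++ Eneg, e.finite ∧ e.I.satO Ont) ∧
  Fits C Epos Eneg ∧
  ∀ D, L D → Fits D Epos Eneg → CEquivO Ont C D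

/-- `L(Os)` admits finite characterisations. -/
def AdmitsFinChar (Os : Finset Op) : Prop :=
  ∀ SC SR : Finset ℕ, ∀ C : Concept, C.inLang Os SC SR →
    ∃ Epos Eneg : List PInterp, FinChar (Concept.inLang Os SC SR) C Epos Eneg

/-- `L(Os)` admits finite characterisations under the ontology `Ont`. -/
def AdmitsFinCharO (Os : Finset Op) (Ont : Ontology) : Prop :=
  ∀ SC SR : Finset ℕ, ∀ C : Concept, C.inLang Os SC SR →
    ∃ Epos Eneg : List PInterp, FinCharO Ont (Concept.inLang Os SC SR) C Epos Eneg

/-! ### Size, role depth, number restrictions -/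

/-- Number of symbols of a concept expression (numbers in binary). -/
def Concept.size : Concept → ℕ
  | .atom _ => 1
  | .top => 1
  | .bot => 1
  | .and C D => C.size + D.size + 1
  | .or C D => C.size + D.size + 1
  | .neg C => C.size + 1
  | .ex _ C => C.size + 2
  | .all _ C => C.size + 2
  | .atLeast k _ C => C.size + 2 + Nat.size k

/-- Role depth of a concept. -/
def Concept.dp : Concept → ℕ
  | .atom _ => 0
  | .top => 0
  | .bot => 0
  | .and C D => max C.dp D.dp
  | .or C D => max C.dp D.dp
  | .neg C => C.dp
  | .ex _ C => C.dp + 1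
  | .all _ C => C.dp + 1
  | .atLeast _ _ C => C.dp + 1

/-- The largest number occurring in a number restriction of `C` (0 if none). -/
def Concept.nr : Concept → ℕ
  | .atom _ => 0
  | .top => 0
  | .bot => 0
  | .and C D => max C.nr D.nr
  | .or C D => max C.nr D.nr
  | .neg C => C.nr
  | .ex _ C => C.nr
  | .all _ C => C.nr
  | .atLeast k _ C => max k C.nr

/-- `WalkOfLength r k x y`: there is an `r`-walk with exactly `k` steps from `x` to `y`. -/
def WalkOfLength {α : Type*} (r : α → α → Prop) : ℕ → α → α → Prop
  | 0 => Eq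
  | k + 1 => fun x z => ∃ y, r x y ∧ WalkOfLength r k y z

namespace WalkOfLength

variable {α : Type*} {r : α → α → Prop}

theorem append {j k : ℕ} {x y z : α} (h : WalkOfLength r j x y) (h' : WalkOfLength r k y z) :
    WalkOfLength r (j + k) x z := by
  induction j generalizing x with
  | zero => cases h; simpa using h'
  | succ j ih =>
    obtain ⟨w, hxw, hw⟩ := h
    rw [Nat.add_right_comm]
    exact ⟨w, hxw, ih hw⟩

theorem of_step {x y : α} (h : r x y) : WalkOfLength r 1 x y := ⟨y, h, rfl⟩

theorem flip {k : ℕ} {x y : α} (h : WalkOfLength r k x y) :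
    WalkOfLength (fun a b => r b a) k y x := by
  induction k generalizing x with
  | zero => exact Eq.symm h
  | succ k ih =>
    obtain ⟨w, hxw, hw⟩ := h
    exact (ih hw).append (of_step hxw)

theorem repeat_closed {c : ℕ} {x : α} (h : WalkOfLength r c x x) (m : ℕ) :
    WalkOfLength r (m * c) x x := by
  induction m with
  | zero => rw [Nat.zero_mul]; exact rfl
  | succ m ih => rw [Nat.succ_mul]; exact ih.append h

theorem exists_vertices {k : ℕ} {x y : α} (h : WalkOfLength r k x y) :
    ∃ f : ℕ → α, f 0 = x ∧ f k = y ∧ ∀ i < k, r (f i) (f (i + 1)) := by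
  induction k generalizing x with
  | zero => exact ⟨fun _ => x, rfl, h, by simp⟩
  | succ k ih =>
    obtain ⟨w, hxw, hw⟩ := h
    obtain ⟨f, hf0, hfk, hf⟩ := ih hw
    refine ⟨fun i => Nat.casesOn i x f, rfl, hfk, fun i hi => ?_⟩
    cases i with
    | zero => simpa [hf0] using hxw
    | succ i => exact hf i (by omega)

theorem of_vertices {f : ℕ → α} {i l : ℕ} (h : ∀ t < i + l, r (f t) (f (t + 1))) :
    WalkOfLength r l (f i) (f (i + l)) := by
  induction l with
  | zero => exact rfl
  | succ l ih => exact (ih fun t ht => h t (by omega)).append (of_step (h (i + l) (by omega)))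

/-- In a type with at most `n` elements, a walk of length `n` runs through a cycle whose length
divides `n!`; repeating that cycle lengthens the walk by `n!`. -/
theorem pump [Finite α] {n : ℕ} (hn : Nat.card α ≤ n) {x y : α} (h : WalkOfLength r n x y) :
    WalkOfLength r (n + n.factorial) x y := by
  obtain ⟨f, rfl, rfl, hf⟩ := h.exists_vertices
  have hninj : ¬ Function.Injective fun i : Fin (n + 1) => f i := fun hinj => by
    have := Nat.card_le_card_of_injective _ hinj
    simp at this
    omega
  obtain ⟨i, j, hij, hlt⟩ : ∃ i j : Fin (n + 1), f i = f j ∧ i < j := by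
    simp only [Function.Injective, not_forall] at hninj
    obtain ⟨a, b, hab, hne⟩ := hninj
    rcases lt_or_gt_of_ne hne with h | h
    · exact ⟨a, b, hab, h⟩
    · exact ⟨b, a, hab.symm, h⟩
  obtain ⟨i, hi⟩ := i
  obtain ⟨j, hj⟩ := j
  simp only [Fin.mk_lt_mk] at hij hlt
  obtain ⟨c, rfl⟩ := Nat.exists_eq_add_of_le hlt.le
  obtain ⟨l, rfl⟩ := Nat.exists_eq_add_of_le (Nat.lt_succ_iff.mp hj)
  obtain ⟨m, hm⟩ := Nat.dvd_factorial (m := c) (n := i + c + l) (by omega) (by omega)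
  have initial : WalkOfLength r i (f 0) (f i) := by
    simpa using of_vertices (f := f) (i := 0) (l := i) fun t ht => hf t (by omega)
  have cycle : WalkOfLength r c (f i) (f i) := by
    have := of_vertices (f := f) (i := i) (l := c) fun t ht => hf t (by omega)
    rwa [← hij] at this
  have final : WalkOfLength r l (f i) (f (i + c + l)) := by
    rw [hij]
    exact of_vertices hf
  have := (initial.append (cycle.repeat_closed (m + 1))).append final
  rw [hm]
  convert this using 1
  ring

theorem eq_add {k x y : ℕ} (h : WalkOfLength (fun a b : ℕ => b = a + 1) k x y) : y = x + k := by
  induction k generalizing x with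
  | zero => exact Eq.symm h
  | succ k ih =>
    obtain ⟨w, rfl, hw⟩ := h
    rw [ih hw]
    ring

theorem add_right (k x : ℕ) : WalkOfLength (fun a b : ℕ => b = a + 1) k x (x + k) :=
  of_vertices (f := id) fun _ _ => rfl

end WalkOfLength

namespace Concept

theorem mem_sem_iterate_all (I : Interp) (S : Role) (C : Concept) (k : ℕ) (d : I.Δ) :
    d ∈ ((Concept.all S)^[k] C).sem I ↔ ∀ e, WalkOfLength (S.sem I) k d e → e ∈ C.sem I := by
  induction k generalizing d with
  | zero => simp [WalkOfLength]
  | succ k ih =>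
    rw [Function.iterate_succ_apply']
    simp only [Concept.sem, Set.mem_ofPred_eq, ih, WalkOfLength]
    grind

theorem mem_sem_iterate_ex (I : Interp) (S : Role) (C : Concept) (k : ℕ) (d : I.Δ) :
    d ∈ ((Concept.ex S)^[k] C).sem I ↔ ∃ e, WalkOfLength (S.sem I) k d e ∧ e ∈ C.sem I := by
  induction k generalizing d with
  | zero => simp [WalkOfLength]
  | succ k ih =>
    rw [Function.iterate_succ_apply']
    simp only [Concept.sem, Set.mem_ofPred_eq, ih, WalkOfLength]
    grind

theorem inLang_iterate_all {Os : Finset Op} {SC SR : Finset ℕ} {S : Role} {C : Concept}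
    (hOs : Op.all ∈ Os) (hS : S.inSig Os SR) (hC : C.inLang Os SC SR) (k : ℕ) :
    ((Concept.all S)^[k] C).inLang Os SC SR := by
  induction k with
  | zero => exact hC
  | succ k ih =>
    rw [Function.iterate_succ_apply']
    exact ⟨hOs, hS, ih⟩

theorem inLang_iterate_ex {Os : Finset Op} {SC SR : Finset ℕ} {S : Role} {C : Concept}
    (hOs : Op.ex ∈ Os) (hS : S.inSig Os SR) (hC : C.inLang Os SC SR) (k : ℕ) :
    ((Concept.ex S)^[k] C).inLang Os SC SR := by
  induction k with
  | zero => exact hC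
  | succ k ih =>
    rw [Function.iterate_succ_apply']
    exact ⟨hOs, hS, ih⟩

/-- The concept `A ⊓ ∀Rⁿ.∃(R⁻)ⁿ⁺ⁿᵎ.A`. -/
def returning (A R n : ℕ) : Concept :=
  (atom A).and ((Concept.all (.name R))^[n] ((Concept.ex (.inv R))^[n + n.factorial] (atom A)))

theorem sem_returning_of_card_le (I : Interp) [Finite I.Δ] (A R : ℕ) {n : ℕ}
    (hn : Nat.card I.Δ ≤ n) : (returning A R n).sem I = (atom A).sem I := by
  refine Set.inter_eq_left.mpr fun d hd => ?_
  rw [mem_sem_iterate_all]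
  intro e hde
  rw [mem_sem_iterate_ex]
  exact ⟨d, (hde.pump hn).flip, hd⟩

theorem not_cEquiv_returning (A R n : ℕ) : ¬ CEquiv (atom A) (returning A R n) := by
  intro h
  let I : Interp := ⟨ℕ, ⟨0⟩, fun _ => {0}, fun _ a b => b = a + 1⟩
  have hmem : (0 : ℕ) ∈ (returning A R n).sem I := by
    rw [← h I]
    exact rfl
  have hret := (mem_sem_iterate_all I _ _ n (0 : ℕ)).mp hmem.2 (0 + n : ℕ)
    (WalkOfLength.add_right n 0)
  obtain ⟨e, hwalk, rfl⟩ := (mem_sem_iterate_ex I _ _ _ _).mp hret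
  have := WalkOfLength.eq_add (WalkOfLength.flip hwalk)
  have := n.factorial_pos
  omega

end Concept

/-- **Theorem**: if `A ∈ SC` and `R ∈ SR`, the concept name `A` has no
finite characterisation w.r.t. `L(∀,∃,−,⊓)[SC,SR]`; in particular
`L(∀,∃,−,⊓)` does not admit finite characterisations. -/
theorem no_finchar_all_ex_inv_and (SC SR : Finset ℕ) (A R : ℕ)
    (hA : A ∈ SC) (hR : R ∈ SR) :
    ¬ ∃ Epos Eneg : List PInterp,
      FinChar (Concept.inLang ({Op.all, Op.ex, Op.inv, Op.and} : Finset Op) SC SR)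
        (Concept.atom A) Epos Eneg := by
  rintro ⟨Epos, Eneg, hfin, ⟨hpos, hneg⟩, hchar⟩
  let n := ((Epos ++ Eneg).map fun e => Nat.card e.I.Δ).sum
  have hsem : ∀ e ∈ Epos ++ Eneg,
      (Concept.returning A R n).sem e.I = (Concept.atom A).sem e.I := fun e he => by
    have : Finite e.I.Δ := hfin e he
    exact Concept.sem_returning_of_card_le e.I A R
      (List.single_le_sum (by simp) _ (List.mem_map_of_mem he))
  refine Concept.not_cEquiv_returning A R n (hchar _ ⟨by simp, hA, ?_⟩ ⟨?_, ?_⟩)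
  · refine Concept.inLang_iterate_all (by simp) ?_ (Concept.inLang_iterate_ex (by simp) ?_ ?_ _) _
    · exact hR
    · exact ⟨by simp, hR⟩
    · exact hA
  · intro e he
    rw [hsem e (List.mem_append_left _ he)]
    exact hpos e he
  · intro e he
    rw [hsem e (List.mem_append_right _ he)]
    exact hneg e he

end DL
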